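/- In the category of finite-dimensional vector spaces over a field k, corelations n → m (jointly-epi cospans k^n → W ← k^m up to isomorphism) are in one-to-one correspondence with subspaces of k^n × k^m: a jointly-epi cospan given by matrices (M1, M2) corresponds to the solution space {(v1,v2) | M1 v1 = M2 v2}. -/

import Mathlib

namespace CorelPaper

/-- A cospan of finite-dimensional vector spaces `k^n → W ← k^m` (for `W` of
dimension `z`, the two legs are given by a `z × n` matrix `M₁` and a `z × m`
matrix `M₂`). -/
structure VCospan (k : Type) [Field k] (n m : ℕ) : Type 1 where
  W : Type
  [grp : AddCommGroup W]
  [mod : Module k W]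
  f : (Fin n → k) →ₗ[k] W
  g : (Fin m → k) →ₗ[k] W

attribute [instance] VCospan.grp VCospan.mod

/-- The copairing `[f | g] : k^n × k^m →ₗ W` of a cospan. -/
def copairing {k : Type} [Field k] {n m : ℕ} (c : VCospan k n m) :
    (Fin n → k) × (Fin m → k) →ₗ[k] c.W :=
  LinearMap.coprod c.f c.g

/-- A cospan is jointly epi when its copairing is surjective. -/
def jointlyEpi {k : Type} [Field k] {n m : ℕ} (c : VCospan k n m) : Prop :=
  Function.Surjective (copairing c)

/-- Isomorphism of cospans: a linear equivalence of apexes commuting with the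
legs. -/
def vCospanIso {k : Type} [Field k] {n m : ℕ} (c d : VCospan k n m) : Prop :=
  ∃ e : c.W ≃ₗ[k] d.W, (e : c.W →ₗ[k] d.W).comp c.f = d.f ∧
    (e : c.W →ₗ[k] d.W).comp c.g = d.g

/-- The solution subspace `{(v₁, v₂) | M₁ v₁ = M₂ v₂}` of a cospan, i.e. the
kernel of `[M₁ | -M₂]`. -/
def solSub {k : Type} [Field k] {n m : ℕ} (c : VCospan k n m) :
    Submodule k ((Fin n → k) × (Fin m → k)) :=
  LinearMap.ker (c.f.comp (LinearMap.fst k _ _) - c.g.comp (LinearMap.snd k _ _))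

/-- The map `[M₁ | -M₂]`, whose kernel is `solSub`, is surjective for a jointly-epi cospan. -/
theorem jointlyEpi.surjective_sub {k : Type} [Field k] {n m : ℕ} {c : VCospan k n m}
    (hc : jointlyEpi c) :
    Function.Surjective
      (c.f.comp (LinearMap.fst k (Fin n → k) (Fin m → k)) -
        c.g.comp (LinearMap.snd k (Fin n → k) (Fin m → k))) := by
  intro w
  obtain ⟨⟨v₁, v₂⟩, rfl⟩ := hc w
  exact ⟨(v₁, -v₂), by simp [copairing]⟩

/-- Isomorphic cospans have the same solution subspace. -/
theorem vCospanIso.solSub_eq {k : Type} [Field k] {n m : ℕ} {c d : VCospan k n m}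
    (h : vCospanIso c d) : solSub c = solSub d := by
  obtain ⟨e, hf, hg⟩ := h
  ext ⟨v₁, v₂⟩
  simp [solSub, ← hf, ← hg, sub_eq_zero]

/-- Jointly-epi cospans with the same solution subspace are isomorphic. -/
theorem vCospanIso_of_solSub_eq {k : Type} [Field k] {n m : ℕ} {c d : VCospan k n m}
    (hc : jointlyEpi c) (hd : jointlyEpi d) (h : solSub c = solSub d) : vCospanIso c d := by
  let e : c.W ≃ₗ[k] d.W :=
    (LinearMap.quotKerEquivOfSurjective _ hc.surjective_sub).symm ≪≫ₗ
      Submodule.quotEquivOfEq _ _ h ≪≫ₗ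
      LinearMap.quotKerEquivOfSurjective _ hd.surjective_sub
  have he (v : (Fin n → k) × (Fin m → k)) : e (c.f v.1 - c.g v.2) = d.f v.1 - d.g v.2 := by
    have hv : (LinearMap.quotKerEquivOfSurjective _ hc.surjective_sub).symm
        (c.f v.1 - c.g v.2) = Submodule.Quotient.mk v := by
      rw [LinearEquiv.symm_apply_eq]
      rfl
    exact congrArg (Submodule.quotEquivOfEq _ _ h ≪≫ₗ
      LinearMap.quotKerEquivOfSurjective _ hd.surjective_sub) hv
  refine ⟨e, LinearMap.ext fun v => ?_, LinearMap.ext fun v => ?_⟩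
  · simpa using he (v, 0)
  · simpa using he (0, v)

/-- The cospan `k^n → (k^n × k^m) ⧸ S ← k^m` with solution subspace `S`. -/
def quotientCospan {k : Type} [Field k] {n m : ℕ}
    (S : Submodule k ((Fin n → k) × (Fin m → k))) : VCospan k n m where
  W := ((Fin n → k) × (Fin m → k)) ⧸ S
  f := S.mkQ.comp (LinearMap.inl k _ _)
  g := -S.mkQ.comp (LinearMap.inr k _ _)

theorem jointlyEpi_quotientCospan {k : Type} [Field k] {n m : ℕ}
    (S : Submodule k ((Fin n → k) × (Fin m → k))) : jointlyEpi (quotientCospan S) := by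
  intro w
  obtain ⟨⟨v₁, v₂⟩, rfl⟩ := S.mkQ_surjective w
  refine ⟨(v₁, -v₂), ?_⟩
  change S.mkQ (v₁, 0) + -S.mkQ (0, -v₂) = S.mkQ (v₁, v₂)
  rw [← map_neg, ← map_add]
  simp

theorem solSub_quotientCospan {k : Type} [Field k] {n m : ℕ}
    (S : Submodule k ((Fin n → k) × (Fin m → k))) : solSub (quotientCospan S) = S := by
  ext ⟨v₁, v₂⟩
  change S.mkQ (v₁, 0) - -S.mkQ (0, v₂) = 0 ↔ _
  rw [sub_neg_eq_add, ← map_add]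
  simp

/-- Corelations `n → m` of finite-dimensional `k`-vector
spaces, i.e. isomorphism classes of jointly-epi cospans `k^n → W ← k^m`, are in
one-to-one correspondence with subspaces of `k^n × k^m`: a jointly-epi cospan
given by matrices `(M₁, M₂)` corresponds to the solution space
`{(v₁, v₂) | M₁ v₁ = M₂ v₂}`. -/
theorem corelations_are_subspaces (k : Type) [Field k] (n m : ℕ) :
    ∃ φ : Quot (fun c d : {c : VCospan k n m // jointlyEpi c} =>
        vCospanIso c.val d.val) → Submodule k ((Fin n → k) × (Fin m → k)),
      (∀ c, φ (Quot.mk _ c) = solSub c.val) ∧ Function.Bijective φ := by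
  refine ⟨Quot.lift (fun c => solSub c.val) fun _ _ h => h.solSub_eq, fun _ => rfl, ?_, ?_⟩
  · rintro ⟨c⟩ ⟨d⟩ h
    exact Quot.sound (vCospanIso_of_solSub_eq c.2 d.2 h)
  · exact fun S =>
      ⟨Quot.mk _ ⟨quotientCospan S, jointlyEpi_quotientCospan S⟩, solSub_quotientCospan S⟩

end CorelPaper
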